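/- Twisted weighted asymptotic Dirichlet theorem for non-singular matrices (real case): Let α be a real m×n matrix that is (τ,η)-non-singular. Then there exist a constant C > 0 (depending only on α, τ, η) and a strictly increasing unbounded sequence (H_i)_{i∈ℕ} of positive reals such that for every i and every γ ∈ ℝ^n there exists (a, b) ∈ ℤ^m × ℤ^n with |aα − b − γ|_τ < C H_i^{-1} and |a|_η ≤ H_i. -/

import Mathlib

/-- The weighted quasi-norm `|x|_τ = max_i |x_i|^(1/τ_i)` on `ℝ^n`. -/
noncomputable def quasiNorm {n : ℕ} (τ : Fin n → ℝ) (x : Fin n → ℝ) : ℝ :=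
  ⨆ i, |x i| ^ (1 / τ i)

/-- `α` is `(τ,η)`-singular. -/
def IsSingular {m n : ℕ} (τ : Fin n → ℝ) (η : Fin m → ℝ)
    (α : Matrix (Fin m) (Fin n) ℝ) : Prop :=
  ∀ ε > (0 : ℝ), ∃ H₀ : ℝ, ∀ H > H₀, ∃ (a : Fin m → ℤ) (b : Fin n → ℤ), a ≠ 0 ∧
    quasiNorm τ (fun i => (∑ j, (a j : ℝ) * α j i) - (b i : ℝ)) < ε * H⁻¹ ∧
    quasiNorm η (fun j => (a j : ℝ)) ≤ H

open MeasureTheory in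
/-- If the nonzero points of a lattice have norm at least `1` and its covolume is less than `N` times
the volume of a ball of radius `1 / 2`, then every point is at distance less than `N` from it. -/
theorem exists_dist_lt_of_one_le_norm {E : Type*} [NormedAddCommGroup E] [NormedSpace ℝ E]
    [MeasurableSpace E] [BorelSpace E] (μ : Measure E) [μ.IsAddHaarMeasure]
    (L : AddSubgroup E) [Countable L] {F : Set E} (fund : IsAddFundamentalDomain L F μ)
    (sep : ∀ x ∈ L, x ≠ 0 → 1 ≤ ‖x‖) (N : ℕ)
    (hN : μ F < N * μ (Metric.ball 0 (1 / 2))) (p : E) :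
    ∃ x ∈ L, dist p x < N := by
  by_contra! hp
  have hne : (L : Set E).Nonempty := ⟨0, L.zero_mem⟩
  have hp' : (N : ℝ) ≤ Metric.infDist p L := (Metric.le_infDist hne).2 fun {x} hx => hp x hx
  have hq : ∀ k : Fin N, ∃ q : E, Metric.infDist q L = (k : ℕ) := fun k =>
    mem_range_of_exists_le_of_exists_ge (Metric.continuous_infDist_pt (L : Set E))
      ⟨0, by rw [Metric.infDist_zero_of_mem L.zero_mem]; positivity⟩
      ⟨p, le_trans (by exact_mod_cast k.2.le) hp'⟩
  choose q hq using hq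
  have hlt : ∀ k l : Fin N, ∀ v ∈ L, dist (q k) (q l + v) < 1 → (k : ℕ) ≤ l := by
    intro k l v hv hd
    obtain ⟨y, hy, hy'⟩ := (Metric.infDist_lt_iff (s := (L : Set E)) (x := q l)
      (r := (l : ℕ) + (1 - dist (q k) (q l + v))) hne).1 (by rw [hq]; linarith)
    have h1 : Metric.infDist (q k) L ≤ dist (q k) (y + v) :=
      Metric.infDist_le_dist_of_mem (L.add_mem hy hv)
    have h2 := dist_triangle (q k) (q l + v) (y + v)
    rw [dist_add_right] at h2
    rw [hq] at h1
    have h3 : ((k : ℕ) : ℝ) < (l : ℕ) + 1 := by linarith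
    exact Nat.lt_succ_iff.1 (by exact_mod_cast h3)
  have key : ∀ k l : Fin N, ∀ v ∈ L, dist (q k) (q l + v) < 1 → k = l ∧ v = 0 := by
    intro k l v hv hd
    have hkl : k = l := by
      refine Fin.ext (le_antisymm (hlt k l v hv hd) (hlt l k (-v) (L.neg_mem hv) ?_))
      rwa [← dist_add_right _ _ v, neg_add_cancel_right, dist_comm]
    refine ⟨hkl, ?_⟩
    subst hkl
    by_contra hv0
    have := sep v hv hv0
    rw [dist_self_add_right] at hd
    linarith
  have hballs : ∀ k l : Fin N, ∀ x ∈ L, ∀ y ∈ L, ∀ z w : E, z ∈ Metric.ball (q k) (1 / 2) →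
      w ∈ Metric.ball (q l) (1 / 2) → x + z = y + w → k = l ∧ x = y := by
    intro k l x hx y hy z w hz hw h
    have h1 : dist (q k) (q l + (y - x)) < 1 := by
      have hz' : z = w + (y - x) := by
        rw [← add_right_inj x, h]; abel
      have h2 := dist_triangle (q k) z (q l + (y - x))
      have h3 : dist z (q l + (y - x)) = dist w (q l) := by rw [hz', dist_add_right]
      rw [Metric.mem_ball] at hz hw
      rw [dist_comm] at hz
      linarith
    obtain ⟨hkl, hv⟩ := key k l _ (L.sub_mem hy hx) h1
    exact ⟨hkl, (sub_eq_zero.1 hv).symm⟩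
  have hvol : μ (⋃ k, Metric.ball (q k) (1 / 2)) = N * μ (Metric.ball 0 (1 / 2)) := by
    rw [measure_iUnion _ fun _ => measurableSet_ball, tsum_fintype]
    · simp [Measure.addHaar_ball_center]
    · intro k l hkl
      rw [Function.onFun, Set.disjoint_left]
      intro z hz hw
      exact hkl (hballs k l 0 L.zero_mem 0 L.zero_mem z z hz hw rfl).1
  obtain ⟨x, y, hxy, hd⟩ := exists_pair_mem_lattice_not_disjoint_vadd fund
    (MeasurableSet.iUnion fun k => measurableSet_ball).nullMeasurableSet (hN.trans_eq hvol.symm)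
  rw [Set.not_disjoint_iff] at hd
  obtain ⟨_, ⟨z, hz, rfl⟩, ⟨w, hw, hzw⟩⟩ := hd
  obtain ⟨k, hk⟩ := Set.mem_iUnion.1 hz
  obtain ⟨l, hl⟩ := Set.mem_iUnion.1 hw
  exact hxy (Subtype.ext (hballs k l x x.2 y y.2 z w hk hl hzw.symm).2)

/-- If the nonzero integer combinations of the rows of a matrix `B` have sup norm at least `1` and
`0 < |det B| < N`, then every point is at sup distance less than `N` from such a combination. -/
theorem exists_int_vecMul_dist_lt {ι : Type*} [Fintype ι] [DecidableEq ι] [Nonempty ι]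
    (B : Matrix ι ι ℝ) (hB : B.det ≠ 0)
    (sep : ∀ c : ι → ℤ, c ≠ 0 → 1 ≤ ‖Matrix.vecMul (fun i => (c i : ℝ)) B‖)
    (N : ℕ) (hN : |B.det| < N) (p : ι → ℝ) :
    ∃ c : ι → ℤ, dist p (Matrix.vecMul (fun i => (c i : ℝ)) B) < N := by
  let b : Module.Basis ι ℝ (ι → ℝ) := basisOfLinearIndependentOfCardEqFinrank
    (Matrix.linearIndependent_rows_of_det_ne_zero hB) (by simp)
  have hb : (b : ι → ι → ℝ) = B := coe_basisOfLinearIndependentOfCardEqFinrank _ _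
  let L := (Submodule.span ℤ (Set.range b)).toAddSubgroup
  have hL : ∀ x, x ∈ L ↔ ∃ c : ι → ℤ, Matrix.vecMul (fun i => (c i : ℝ)) B = x := by
    intro x
    rw [Submodule.mem_toAddSubgroup, Submodule.mem_span_range_iff_exists_fun]
    refine exists_congr fun c => ?_
    rw [Matrix.vecMul_eq_sum, hb]
    simp only [Int.cast_smul_eq_zsmul]
  have : Countable L := inferInstanceAs (Countable (Submodule.span ℤ (Set.range b)))
  have hvol : MeasureTheory.volume (Metric.ball (0 : ι → ℝ) (1 / 2)) = 1 := by
    rw [Real.volume_pi_ball _ (by norm_num)]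
    norm_num
  obtain ⟨x, hx, hpx⟩ := exists_dist_lt_of_one_le_norm MeasureTheory.volume L
    (ZSpan.isAddFundamentalDomain' b _) (fun x hx hx0 => by
      obtain ⟨c, rfl⟩ := (hL x).1 hx
      refine sep c ?_
      rintro rfl
      exact hx0 (by simp [← Pi.zero_def])) N (by
      rw [ZSpan.volume_fundamentalDomain, hb, hvol, mul_one, ← ENNReal.ofReal_natCast]
      exact (ENNReal.ofReal_lt_ofReal_iff_of_nonneg (abs_nonneg _)).2 hN) p
  obtain ⟨c, rfl⟩ := (hL x).1 hx
  exact ⟨c, hpx⟩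

theorem quasiNorm_lt_iff {n : ℕ} (hn : 0 < n) {τ : Fin n → ℝ} (hτ : ∀ i, 0 < τ i)
    (x : Fin n → ℝ) {c : ℝ} (hc : 0 ≤ c) : quasiNorm τ x < c ↔ ∀ i, |x i| < c ^ τ i := by
  have : Nonempty (Fin n) := ⟨⟨0, hn⟩⟩
  have h : ∀ i, |x i| ^ (1 / τ i) < c ↔ |x i| < c ^ τ i := fun i => by
    rw [one_div, Real.rpow_inv_lt_iff_of_pos (abs_nonneg _) hc (hτ i)]
  simp only [← h]
  refine ⟨fun hx i => lt_of_le_of_lt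
    (le_ciSup (f := fun i => |x i| ^ (1 / τ i)) (Set.finite_range _).bddAbove i) hx, fun hx => ?_⟩
  obtain ⟨i, hi⟩ := exists_eq_ciSup_of_finite (f := fun i => |x i| ^ (1 / τ i))
  exact hi.symm.trans_lt (hx i)

/-- The covering statement at a single scale `H` at which the homogeneous system has no nontrivial
solution. -/
theorem exists_twisted_approx {m n : ℕ} (hm : 0 < m) (hn : 0 < n)
    {τ : Fin n → ℝ} {η : Fin m → ℝ} (hτ : ∀ i, 0 < τ i) (hη : ∀ j, 0 < η j)
    (hw : ∑ i, τ i = ∑ j, η j) (α : Matrix (Fin m) (Fin n) ℝ)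
    {ε H : ℝ} (hε : 0 < ε) (hεH : ε ≤ H)
    (hno : ∀ (a : Fin m → ℤ) (b : Fin n → ℤ), a ≠ 0 →
      quasiNorm τ (fun i => (∑ j, (a j : ℝ) * α j i) - (b i : ℝ)) < ε * H⁻¹ →
      ¬ quasiNorm η (fun j => (a j : ℝ)) ≤ H)
    {N : ℕ} (hN : (∏ i, ε ^ τ i)⁻¹ < N) {S : ℝ} (hS : 0 < S)
    (hSτ : ∀ i, (N : ℝ) ≤ S ^ τ i) (hSη : ∀ j, (N : ℝ) ≤ S ^ η j) (γ : Fin n → ℝ) :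
    ∃ (a : Fin m → ℤ) (b : Fin n → ℤ),
      quasiNorm τ (fun k => (∑ j, (a j : ℝ) * α j k) - (b k : ℝ) - γ k) < S * (ε * H⁻¹) ∧
      quasiNorm η (fun j => (a j : ℝ)) < S * H := by
  have hH : 0 < H := hε.trans_le hεH
  have hr : 0 < ε * H⁻¹ := by positivity
  have : Nonempty (Fin n) := ⟨⟨0, hn⟩⟩
  let r : Fin m ⊕ Fin n → ℝ := Sum.elim (fun j => H ^ η j) (fun i => (ε * H⁻¹) ^ τ i)
  have hr0 : ∀ s, 0 < r s := by
    rintro (j | i)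
    · exact Real.rpow_pos_of_pos hH _
    · exact Real.rpow_pos_of_pos hr _
  let B : Matrix (Fin m ⊕ Fin n) (Fin m ⊕ Fin n) ℝ :=
    Matrix.fromBlocks 1 α 0 (-1) * Matrix.diagonal fun s => (r s)⁻¹
  have hprod : ∏ s, (r s)⁻¹ = (∏ i, ε ^ τ i)⁻¹ := by
    rw [Finset.prod_inv_distrib, Fintype.prod_sum_type]
    congr 1
    simp only [r, Sum.elim_inl, Sum.elim_inr, Real.mul_rpow hε.le (inv_nonneg.2 hH.le),
      Finset.prod_mul_distrib]
    rw [← Real.rpow_sum_of_pos hH, ← Real.rpow_sum_of_pos (inv_pos.2 hH), hw,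
      Real.inv_rpow hH.le]
    have := (Real.rpow_pos_of_pos hH (∑ j, η j)).ne'
    field_simp
  have hprodpos : 0 < ∏ s, (r s)⁻¹ := Finset.prod_pos fun s _ => inv_pos.2 (hr0 s)
  have hdet : |B.det| = (∏ i, ε ^ τ i)⁻¹ := by
    rw [Matrix.det_mul, Matrix.det_fromBlocks_zero₂₁, Matrix.det_diagonal, Matrix.det_neg,
      abs_mul, abs_of_pos hprodpos, hprod]
    simp
  have hinl : ∀ (c : Fin m ⊕ Fin n → ℤ) j, Matrix.vecMul (fun s => (c s : ℝ)) B (Sum.inl j) =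
      c (Sum.inl j) * (H ^ η j)⁻¹ := by
    intro c j
    simp [B, r, Matrix.vecMul, dotProduct,
      Matrix.one_apply]
  have hinr : ∀ (c : Fin m ⊕ Fin n → ℤ) i, Matrix.vecMul (fun s => (c s : ℝ)) B (Sum.inr i) =
      ((∑ j, (c (Sum.inl j) : ℝ) * α j i) - c (Sum.inr i)) * ((ε * H⁻¹) ^ τ i)⁻¹ := by
    intro c i
    rw [← Matrix.vecMul_vecMul, Matrix.vecMul_diagonal]
    simp [r, Matrix.vecMul, dotProduct, Matrix.one_apply, sub_eq_add_neg]
  have hsep : ∀ c : Fin m ⊕ Fin n → ℤ, c ≠ 0 →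
      1 ≤ ‖Matrix.vecMul (fun i => (c i : ℝ)) B‖ := by
    intro c hc
    by_contra! hlt
    rw [pi_norm_lt_iff one_pos] at hlt
    have h1 : ∀ j, |(c (Sum.inl j) : ℝ)| < H ^ η j := by
      intro j
      have := hlt (Sum.inl j)
      rwa [hinl, Real.norm_eq_abs, abs_mul, abs_inv, abs_of_pos (Real.rpow_pos_of_pos hH _),
        ← div_eq_mul_inv, div_lt_one (Real.rpow_pos_of_pos hH _)] at this
    have h2 : ∀ i, |(∑ j, (c (Sum.inl j) : ℝ) * α j i) - c (Sum.inr i)| < (ε * H⁻¹) ^ τ i := by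
      intro i
      have := hlt (Sum.inr i)
      rwa [hinr, Real.norm_eq_abs, abs_mul, abs_inv, abs_of_pos (Real.rpow_pos_of_pos hr _),
        ← div_eq_mul_inv, div_lt_one (Real.rpow_pos_of_pos hr _)] at this
    by_cases ha : (fun j => c (Sum.inl j)) = 0
    · have ha' : ∀ j, c (Sum.inl j) = 0 := fun j => congrFun ha j
      refine hc (funext fun s => ?_)
      rcases s with j | i
      · exact ha' j
      · have h3 := (h2 i).trans_le (Real.rpow_le_one hr.le
          (by rwa [← div_eq_mul_inv, div_le_one hH]) (hτ i).le)
        simp only [ha', Int.cast_zero, zero_mul, Finset.sum_const_zero, zero_sub, abs_neg] at h3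
        exact Int.abs_lt_one_iff.1 (by exact_mod_cast h3)
    · exact hno _ (fun i => c (Sum.inr i)) ha ((quasiNorm_lt_iff hn hτ _ hr.le).2 h2)
        ((quasiNorm_lt_iff hm hη _ hH.le).2 h1).le
  have hB : B.det ≠ 0 := by
    rw [← abs_pos, hdet, ← hprod]
    exact hprodpos
  obtain ⟨c, hc⟩ := exists_int_vecMul_dist_lt B hB hsep N (hdet.trans_lt hN)
    (Sum.elim (fun _ => 0) (fun i => γ i * ((ε * H⁻¹) ^ τ i)⁻¹))
  have hN0 : (0 : ℝ) < N := lt_of_le_of_lt (abs_nonneg _) (hdet.trans_lt hN)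
  rw [dist_comm, dist_pi_lt_iff hN0] at hc
  refine ⟨fun j => c (Sum.inl j), fun i => c (Sum.inr i),
    (quasiNorm_lt_iff hn hτ _ (by positivity)).2 fun i => ?_,
    (quasiNorm_lt_iff hm hη _ (by positivity)).2 fun j => ?_⟩
  · have hpos := Real.rpow_pos_of_pos hr (τ i)
    have := hc (Sum.inr i)
    rw [hinr, Sum.elim_inr, Real.dist_eq, ← sub_mul, abs_mul, abs_inv, abs_of_pos hpos,
      ← div_eq_mul_inv, div_lt_iff₀ hpos] at this
    rw [Real.mul_rpow hS.le hr.le]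
    exact this.trans_le (mul_le_mul_of_nonneg_right (hSτ i) hpos.le)
  · have hpos := Real.rpow_pos_of_pos hH (η j)
    have := hc (Sum.inl j)
    rw [hinl, Sum.elim_inl, Real.dist_eq, sub_zero, abs_mul, abs_inv, abs_of_pos hpos,
      ← div_eq_mul_inv, div_lt_iff₀ hpos] at this
    rw [Real.mul_rpow hS.le hH.le]
    exact this.trans_le (mul_le_mul_of_nonneg_right (hSη j) hpos.le)

/-- A set of reals unbounded above contains a strictly increasing sequence of numbers exceeding a
given bound and tending to infinity. -/
theorem exists_strictMono_seq_of_unbounded {P : ℝ → Prop} (hP : ∀ x, ∃ y > x, P y) (x₀ : ℝ) :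
    ∃ u : ℕ → ℝ, (∀ k, P (u k)) ∧ (∀ k, x₀ < u k) ∧ StrictMono u ∧ ∀ M, ∃ k, M < u k := by
  choose g hg hPg using hP
  let u : ℕ → ℝ := fun k => Nat.rec (g x₀) (fun _ x => g (x + 1)) k
  have hsucc : ∀ k, u k + 1 < u (k + 1) := fun k => hg (u k + 1)
  have hmono : StrictMono u := strictMono_nat_of_lt_succ fun k => by linarith [hsucc k]
  have hlow : ∀ k : ℕ, x₀ + k < u k := by
    intro k
    induction k with
    | zero => simpa [u] using hg x₀
    | succ k ih => push_cast; linarith [hsucc k]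
  refine ⟨u, fun k => ?_, fun k => ?_, hmono, fun M => ?_⟩
  · cases k with
    | zero => exact hPg x₀
    | succ k => exact hPg (u k + 1)
  · exact (le_add_of_nonneg_right k.cast_nonneg).trans_lt (hlow k)
  · obtain ⟨k, hk⟩ := exists_nat_gt (M - x₀)
    exact ⟨k, by linarith [hlow k]⟩

/-- Twisted weighted asymptotic Dirichlet theorem for non-singular matrices (real case). -/
theorem twisted_weighted_asymptotic_dirichlet (m n : ℕ) (hm : 0 < m) (hn : 0 < n)
    (τ : Fin n → ℝ) (η : Fin m → ℝ)
    (hτ : ∀ i, 0 < τ i) (hη : ∀ j, 0 < η j)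
    (hw : ∑ i, τ i = ∑ j, η j)
    (α : Matrix (Fin m) (Fin n) ℝ) (hα : ¬ IsSingular τ η α) :
    ∃ (C : ℝ), 0 < C ∧ ∃ H : ℕ → ℝ, (∀ i, 0 < H i) ∧ StrictMono H ∧
      (∀ M : ℝ, ∃ i, M < H i) ∧
      ∀ (i : ℕ) (γ : Fin n → ℝ), ∃ (a : Fin m → ℤ) (b : Fin n → ℤ),
        quasiNorm τ (fun k => (∑ j, (a j : ℝ) * α j k) - (b k : ℝ) - γ k) < C * (H i)⁻¹ ∧
        quasiNorm η (fun j => (a j : ℝ)) ≤ H i := by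
  unfold IsSingular at hα
  push Not at hα
  obtain ⟨ε, hε, hα⟩ := hα
  obtain ⟨u, hu, hεu, hmono, hunb⟩ := exists_strictMono_seq_of_unbounded hα ε
  obtain ⟨N, hN⟩ := exists_nat_gt (∏ i, ε ^ τ i)⁻¹
  obtain ⟨S, hS, hSτ, hSη⟩ : ∃ S : ℝ, 0 < S ∧ (∀ i, (N : ℝ) ≤ S ^ τ i) ∧
      ∀ j, (N : ℝ) ≤ S ^ η j :=
    ((Filter.eventually_gt_atTop 0).and
      ((Filter.eventually_all.2 fun i => (tendsto_rpow_atTop (hτ i)).eventually_ge_atTop _).and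
        (Filter.eventually_all.2 fun j =>
          (tendsto_rpow_atTop (hη j)).eventually_ge_atTop _))).exists
  have hu0 : ∀ i, 0 < u i := fun i => hε.trans (hεu i)
  refine ⟨S * S * ε, by positivity, fun i => S * u i, fun i => mul_pos hS (hu0 i),
    fun i j hij => mul_lt_mul_of_pos_left (hmono hij) hS, fun M => ?_, fun i γ => ?_⟩
  · obtain ⟨i, hi⟩ := hunb (M / S)
    exact ⟨i, by rwa [div_lt_iff₀' hS] at hi⟩
  · obtain ⟨a, b, hab, ha⟩ := exists_twisted_approx hm hn hτ hη hw α hε (hεu i).le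
      (fun a b h0 h => (hu i a b h0 h).not_ge) hN hS hSτ hSη γ
    refine ⟨a, b, hab.trans_eq ?_, ha.le⟩
    have := (hu0 i).ne'
    field_simp
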